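/- Let k ≥ 2 be an integer, let c ∈ (0,1), and let (M_n) be a sequence of integers with 1 ≤ M_n ≤ kn−1 and M_n/(kn) → c. Then lim_{n→∞} Σ_{l=1}^{k−1} C(M_n,l)·(k)_l·(k(n−1))_{M_n−l} / (kn)_{M_n} = (1−c)^k·Σ_{l=1}^{k−1} C(k,l)·(c/(1−c))^l, where any falling factorial (b)_a with a > b is interpreted as 0. -/

import Mathlib

open Finset Filter

open scoped Classical

/-- Symmetry of the hypergeometric weights: exchanging the sample size `M` and the number of
marked elements `k`. -/
theorem choose_mul_descFactorial_hypergeometric_symm {k l : ℕ} (hl : l ≤ k) (M N : ℕ) :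
    M.choose l * k.descFactorial l * (N - k).descFactorial (M - l) * N.descFactorial k =
      k.choose l * M.descFactorial l * (N - M).descFactorial (k - l) * N.descFactorial M := by
  rcases lt_or_ge M l with h | h
  · simp [Nat.choose_eq_zero_of_lt h, Nat.descFactorial_of_lt h]
  · have h1 := Nat.descFactorial_mul_descFactorial (n := N) (show k ≤ k + M - l by omega)
    have h2 := Nat.descFactorial_mul_descFactorial (n := N) (show M ≤ k + M - l by omega)
    rw [show k + M - l - k = M - l by omega] at h1
    rw [show k + M - l - M = k - l by omega] at h2
    rw [mul_assoc, h1, mul_assoc (k.choose l * _), h2, Nat.descFactorial_eq_factorial_mul_choose k,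
      Nat.descFactorial_eq_factorial_mul_choose M]
    ring

theorem hypergeometric_weight_eq {k l M N : ℕ} (hl : l ≤ k) (hk : k ≤ N) (hM : M ≤ N) :
    (M.choose l : ℝ) * k.descFactorial l * (N - k).descFactorial (M - l) / N.descFactorial M =
      k.choose l * M.descFactorial l * (N - M).descFactorial (k - l) / N.descFactorial k := by
  have hpos : ∀ {j : ℕ}, j ≤ N → (N.descFactorial j : ℝ) ≠ 0 := fun hj => by
    simpa [Nat.descFactorial_eq_zero_iff_lt] using hj
  rw [div_eq_div_iff (hpos hM) (hpos hk)]
  exact_mod_cast choose_mul_descFactorial_hypergeometric_symm hl M N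

theorem tendsto_descFactorial_div_pow {ι : Type*} {f : Filter ι} {a : ι → ℕ} {b : ι → ℝ} {x : ℝ}
    (hb : Tendsto b f atTop) (hab : Tendsto (fun i => (a i : ℝ) / b i) f (nhds x)) (j : ℕ) :
    Tendsto (fun i => ((a i).descFactorial j : ℝ) / b i ^ j) f (nhds (x ^ j)) := by
  induction j with
  | zero => simpa using tendsto_const_nhds
  | succ j ih =>
    have hfac : Tendsto (fun i => ((a i - j : ℕ) : ℝ) / b i) f (nhds x) := by
      have hlow : Tendsto (fun i => (a i : ℝ) / b i - j / b i) f (nhds x) := by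
        simpa using hab.sub (hb.const_div_atTop (j : ℝ))
      refine tendsto_of_tendsto_of_tendsto_of_le_of_le' hlow hab ?_ ?_
      · filter_upwards [hb.eventually_gt_atTop 0] with i hi
        rw [← sub_div]
        gcongr
        rw [sub_le_iff_le_add]
        exact_mod_cast le_tsub_add
      · filter_upwards [hb.eventually_gt_atTop 0] with i hi
        gcongr
        exact Nat.sub_le _ _
    rw [pow_succ']
    refine (hfac.mul ih).congr fun i => ?_
    rw [Nat.descFactorial_succ, Nat.cast_mul, pow_succ', mul_div_mul_comm]

/-- Equation (3.14): the limit of the first term of the formula of Proposition 1. -/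
theorem secretary_multirank_first_term_limit (k : ℕ) (hk : 2 ≤ k) (c : ℝ)
    (hc : c ∈ Set.Ioo (0:ℝ) 1)
    (M : ℕ → ℕ) (hM : ∀ n, 1 ≤ n → 1 ≤ M n ∧ M n ≤ k*n - 1)
    (hlim : Tendsto (fun n : ℕ => (M n : ℝ) / ((k : ℝ) * n)) atTop (nhds c)) :
    Tendsto (fun n : ℕ =>
        ∑ l ∈ Finset.Icc 1 (k-1),
          ((M n).choose l : ℝ) * (Nat.descFactorial k l : ℝ)
              * (Nat.descFactorial (k*(n-1)) (M n - l) : ℝ)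
            / (Nat.descFactorial (k*n) (M n) : ℝ)) atTop
      (nhds ((1-c)^k * ∑ l ∈ Finset.Icc 1 (k-1), (k.choose l : ℝ) * (c/(1-c))^l)) := by
  obtain ⟨hc0, hc1⟩ := hc
  have hkR : (0 : ℝ) < k := by exact_mod_cast (by omega : 0 < k)
  have hN : Tendsto (fun n : ℕ => (k : ℝ) * n) atTop atTop :=
    tendsto_natCast_atTop_atTop.const_mul_atTop hkR
  have hMle : ∀ n, 1 ≤ n → M n ≤ k * n := fun n hn => (hM n hn).2.trans (Nat.sub_le _ _)
  have hself : Tendsto (fun n : ℕ => ((k * n : ℕ) : ℝ) / (k * n)) atTop (nhds 1) := by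
    refine tendsto_const_nhds.congr' ?_
    filter_upwards [hN.eventually_gt_atTop 0] with n hn
    rw [Nat.cast_mul, div_self hn.ne']
  have hcompl : Tendsto (fun n : ℕ => ((k * n - M n : ℕ) : ℝ) / (k * n)) atTop
      (nhds (1 - c)) := by
    refine (hself.sub hlim).congr' ?_
    filter_upwards [eventually_ge_atTop 1] with n hn
    rw [Nat.cast_sub (hMle n hn), sub_div]
  rw [Finset.mul_sum]
  refine tendsto_finsetSum _ fun l hl => ?_
  have hlk : l ≤ k := by
    have := (Finset.mem_Icc.mp hl).2
    omega
  have hval : (1 - c) ^ k * ((k.choose l : ℝ) * (c / (1 - c)) ^ l) =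
      k.choose l * (c ^ l * (1 - c) ^ (k - l) / 1 ^ k) := by
    have : (1 - c) ≠ 0 := by linarith
    rw [← pow_sub_mul_pow (1 - c) hlk, div_pow]
    field_simp
    simp
  rw [hval]
  refine (((tendsto_descFactorial_div_pow hN hlim l).mul
    (tendsto_descFactorial_div_pow hN hcompl (k - l))).div
    (tendsto_descFactorial_div_pow hN hself k) (by simp)).const_mul _ |>.congr' ?_
  filter_upwards [eventually_ge_atTop 1, hN.eventually_gt_atTop 0] with n hn hpos
  rw [Pi.div_apply, Nat.mul_sub_one, hypergeometric_weight_eq hlk (Nat.le_mul_of_pos_right k hn) (hMle n hn),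
    div_mul_div_comm, ← pow_add, Nat.add_sub_cancel' hlk,
    div_div_div_cancel_right₀ (pow_pos hpos k).ne']
  ring
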